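/- Fix a query node u ∈ V, an error parameter ε with 0 < ε ≤ c, and a failure probability δ ∈ (0,1), and set n = |V| and n_r = ⌈(3c/ε²)·log(n/δ)⌉. Let W_1, …, W_{n_r} be i.i.d. √c-walks from u, and for each node v ≠ u define the estimator s̃(u,v) := (1/n_r)·∑_{k=1}^{n_r} s̃_{W_k}(v). Then with probability at least 1−δ, simultaneously for all nodes v ∈ V with v ≠ u, |s̃(u,v) − s(u,v)| ≤ ε. -/

import Mathlib

open scoped BigOperators Classical

variable {V : Type*}

/-- `p` is a possible realization of a `√c`-walk from `u`: it is nonempty,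
starts at `u`, and each step moves to an in-neighbor of the current node. -/
def IsWalkFrom (I : V → Finset V) (u : V) (p : List V) : Prop :=
  p.head? = some u ∧ List.Chain' (fun a b => b ∈ I a) p

/-- The probability that the `√c`-walk from `u` is exactly the finite sequence `p`:
`(1−√c)·∏_{k=1}^{ℓ−1} (√c/|I(u_k)|)` if `p = (u_1,…,u_ℓ)` is a walk from `u`,
and `0` otherwise. -/
noncomputable def walkWeight (I : V → Finset V) (c : ℝ) (u : V) (p : List V) : ℝ :=
  if IsWalkFrom I u p then
    (1 - Real.sqrt c) *
      ∏ k ∈ Finset.range (p.length - 1), Real.sqrt c / ((I (p.getD k u)).card : ℝ)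
  else 0

/-- Two finite sequences meet: for some index both sequences are long enough and
their entries at that index coincide. -/
def Meets (w₁ w₂ : List V) : Prop :=
  ∃ k, k < w₁.length ∧ k < w₂.length ∧ w₁[k]? = w₂[k]?

/-- SimRank `s(u,v)`: the probability that two independent `√c`-walks from `u`
and from `v` meet. -/
noncomputable def simRank (I : V → Finset V) (c : ℝ) (u v : V) : ℝ :=
  ∑' w : List V × List V,
    walkWeight I c u w.1 * walkWeight I c v w.2 * (if Meets w.1 w.2 then 1 else 0)

/-- Deterministic PROBE scores of a reverse path, where `q` is the *reversed*
reverse path, i.e. `q = (u_i, u_{i-1}, …, u_1)` for the reverse path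
`(u_1,…,u_i)`: `Score(v,0) = 1` iff `v = u_i`, and `Score(v,j+1) = 0` if
`v = u_{i-j-1}` (which is `q[j+1]`), else `∑_{x∈I(v)} (√c/|I(v)|)·Score(x,j)`. -/
noncomputable def Score (I : V → Finset V) (c : ℝ) (q : List V) : ℕ → V → ℝ
  | 0, v => if q.head? = some v then 1 else 0
  | j + 1, v =>
      if q[j + 1]? = some v then 0
      else ∑ x ∈ I v, Real.sqrt c / ((I v).card : ℝ) * Score I c q j x

/-- The single-trial estimator `s̃_W(v) = ∑_{i=2}^{ℓ} Score^{(i)}(v, i−1)` for a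
fixed sequence `W = p`, where `Score^{(i)}` denotes the PROBE scores of the
prefix `(u_1,…,u_i)`. -/
noncomputable def estimator (I : V → Finset V) (c : ℝ) (p : List V) (v : V) : ℝ :=
  ∑ i ∈ Finset.Icc 2 p.length, Score I c ((p.take i).reverse) (i - 1) v

section generic

theorem hasSum_pi_aux {α : Type*} (f : α → ℝ) (s : ℝ) (hf : HasSum f s) (h0 : ∀ a, 0 ≤ f a)
    (n : ℕ) : HasSum (fun W : Fin n → α => ∏ k, f (W k)) (s ^ n) := by
  induction n with
  | zero =>
    simp only [Finset.univ_eq_empty, Finset.prod_empty, pow_zero]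
    simp
  | succ n ih =>
    have h4 : (0 : (Fin n → α) → ℝ) ≤ fun W : Fin n → α => ∏ k, f (W k) :=
      fun W => Finset.prod_nonneg (fun k _ => h0 _)
    have h1 : Summable (fun x : α × (Fin n → α) => f x.1 * ∏ k, f (x.2 k)) :=
      hf.summable.mul_of_nonneg (g := fun W : Fin n → α => ∏ k, f (W k)) ih.summable h0 h4
    have h2 := hf.mul ih h1
    have h3 : (fun W : Fin (n + 1) → α => ∏ k, f (W k)) ∘ (Fin.consEquiv (fun _ => α)) =
        fun x : α × (Fin n → α) => f x.1 * ∏ k, f (x.2 k) := by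
      funext x
      simp [Fin.consEquiv, Fin.prod_univ_succ]
    rw [pow_succ', ← (Fin.consEquiv (fun _ => α)).hasSum_iff, h3]
    exact h2

theorem mgf_aux {α : Type*} (w X : α → ℝ) (μ l : ℝ) (h0 : ∀ a, 0 ≤ w a) (hw : HasSum w 1)
    (hX : ∀ a, w a = 0 ∨ (0 ≤ X a ∧ X a ≤ 1)) (hμ : HasSum (fun a => w a * X a) μ) :
    ∃ m, HasSum (fun a => w a * Real.exp (l * X a)) m ∧ 0 ≤ m ∧
      m ≤ Real.exp (μ * (Real.exp l - 1)) := by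
  have h1 : HasSum (fun a => w a + (w a * X a) * (Real.exp l - 1))
      (1 + μ * (Real.exp l - 1)) := hw.add (hμ.mul_right _)
  have h2 : ∀ a, w a * Real.exp (l * X a) ≤ w a + (w a * X a) * (Real.exp l - 1) := by
    intro a
    rcases hX a with h | ⟨h, h'⟩
    · simp [h]
    · have hc := convexOn_exp.2 (Set.mem_univ 0) (Set.mem_univ l) (sub_nonneg.2 h') h (by ring)
      simp only [smul_eq_mul, mul_zero, zero_add, Real.exp_zero, mul_one] at hc
      rw [mul_comm (X a)] at hc
      nlinarith [mul_le_mul_of_nonneg_left hc (h0 a)]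
  have h3 : ∀ a, 0 ≤ w a * Real.exp (l * X a) := fun a => mul_nonneg (h0 a) (Real.exp_pos _).le
  have hs : Summable (fun a => w a * Real.exp (l * X a)) :=
    Summable.of_nonneg_of_le h3 h2 h1.summable
  refine ⟨_, hs.hasSum, tsum_nonneg h3, ?_⟩
  refine (hasSum_le h2 hs.hasSum h1).trans ?_
  have := Real.add_one_le_exp (μ * (Real.exp l - 1))
  linarith

theorem tail_aux {α : Type*} (w X : α → ℝ) (μ l C : ℝ) (n : ℕ) (h0 : ∀ a, 0 ≤ w a)
    (hw : HasSum w 1)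
    (hX : ∀ a, w a = 0 ∨ (0 ≤ X a ∧ X a ≤ 1)) (hμ : HasSum (fun a => w a * X a) μ) :
    ∃ m, HasSum (fun W : Fin n → α => (∏ k, w (W k)) * Real.exp (l * (∑ k, X (W k)) + C)) m ∧
      m ≤ Real.exp (n * (μ * (Real.exp l - 1)) + C) := by
  obtain ⟨m, hm, hm0, hm1⟩ := mgf_aux w X μ l h0 hw hX hμ
  have h1 := (hasSum_pi_aux _ m hm (fun a => mul_nonneg (h0 a) (Real.exp_pos _).le) n).mul_right
    (Real.exp C)
  refine ⟨m ^ n * Real.exp C, ?_, ?_⟩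
  · have h2 : (fun W : Fin n → α => (∏ k, w (W k)) * Real.exp (l * (∑ k, X (W k)) + C)) =
        fun W : Fin n → α => (∏ k, w (W k) * Real.exp (l * X (W k))) * Real.exp C := by
      funext W
      rw [Finset.prod_mul_distrib, ← Real.exp_sum, Real.exp_add, Finset.mul_sum]
      ring
    rw [h2]
    exact h1
  · rw [Real.exp_add, Real.exp_nat_mul]
    gcongr

theorem upper_exp (y : ℝ) (h0 : 0 ≤ y) (h1 : y ≤ 7 / 10) :
    Real.exp y - 1 - y ≤ (643 / 1000) * y ^ 2 := by
  have h := Real.exp_bound' h0 (by linarith : y ≤ 1) (n := 4) (by norm_num)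
  simp [Finset.sum_range_succ, Nat.factorial] at h
  have e3 : y ^ 3 ≤ (7 / 10) * y ^ 2 := by nlinarith [sq_nonneg y]
  have e4 : y ^ 4 ≤ (49 / 100) * y ^ 2 := by nlinarith [sq_nonneg y]
  nlinarith [sq_nonneg y]

theorem lower_exp (x : ℝ) (h0 : 0 ≤ x) : Real.exp (-x) - 1 + x ≤ x ^ 2 / 2 := by
  have h := Real.quadratic_le_exp_of_nonneg h0
  have hp := Real.exp_pos (-x)
  have h2 : Real.exp (-x) * Real.exp x = 1 := by rw [← Real.exp_add]; simp
  have h3 : Real.exp (-x) * (1 + x + x ^ 2 / 2) ≤ 1 := by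
    exact (mul_le_mul_of_nonneg_left h hp.le).trans h2.le
  have h4 : (1 - x + x ^ 2 / 2) * (1 + x + x ^ 2 / 2) = 1 + x ^ 4 / 4 := by ring
  have h5 : 0 < 1 + x + x ^ 2 / 2 := by positivity
  have h6 : Real.exp (-x) ≤ 1 - x + x ^ 2 / 2 := by
    refine le_of_mul_le_mul_right ?_ h5
    rw [h4]
    have : 0 ≤ x ^ 4 := by positivity
    linarith
  linarith

theorem final_num (N : ℕ) (hN : 0 < N) (δ : ℝ) (hδ0 : 0 < δ) (hδ1 : δ < 1) :
    ((N : ℝ) - 1) * (Real.exp (-(8 / 7) * Real.log (N / δ)) + Real.exp (-(3 / 2) * Real.log (N / δ)))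
      ≤ δ := by
  have hN' : (1 : ℝ) ≤ N := by exact_mod_cast hN
  set L := Real.log (N / δ) with hL
  set r := Real.exp (-L) with hr
  have hr' : r = δ / N := by
    rw [hr, hL, Real.exp_neg, Real.exp_log (by positivity), inv_div]
  set y := Real.exp (-L / 7) with hy
  set z := Real.exp (-L / 2) with hz
  have hy0 : 0 < y := Real.exp_pos _
  have hz0 : 0 < z := Real.exp_pos _
  have hr0 : 0 < r := Real.exp_pos _
  have hy7 : y ^ 7 = r := by rw [hy, hr, ← Real.exp_nat_mul]; congr 1; push_cast; ring
  have hz2 : z ^ 2 = r := by rw [hz, hr, ← Real.exp_nat_mul]; congr 1; push_cast; ring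
  have e1 : Real.exp (-(8 / 7) * L) = r * y := by
    rw [hy, hr, ← Real.exp_add]; congr 1; ring
  have e2 : Real.exp (-(3 / 2) * L) = r * z := by
    rw [hz, hr, ← Real.exp_add]; congr 1; ring
  rw [e1, e2]
  have b1 : y ≤ (795 / 1000) * (6 / 7) + (795 / 1000) * (5 / 7) * r := by
    have hb := one_add_mul_le_pow (a := y / (795 / 1000) - 1)
      (by have : 0 ≤ y / (795 / 1000) := by positivity
          linarith) 7
    have : (1 + (y / (795 / 1000) - 1)) ^ 7 = r / (795 / 1000) ^ 7 := by
      rw [← hy7]; ring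
    rw [this] at hb
    push_cast at hb
    have h5 : r / (795 / 1000) ^ 7 ≤ 5 * r := by
      rw [div_le_iff₀ (by norm_num)]
      nlinarith
    linarith
  have b2 : z ≤ (4473 / 10000) * (1 / 2) + (4473 / 10000) * (5 / 2) * r := by
    rw [← hz2]
    nlinarith [sq_nonneg (z - 4473 / 10000)]
  have hNr : (N : ℝ) * r = δ := by rw [hr']; field_simp
  have hq : (1 - r) * (y + z) ≤ 1 := by
    have hr1 : r ≤ 1 := by rw [hr', div_le_one (by positivity)]; linarith
    have := mul_le_mul_of_nonneg_left (add_le_add b1 b2) (sub_nonneg.2 hr1)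
    nlinarith [sq_nonneg (r - 23 / 100)]
  have hN1 : (N : ℝ) - 1 ≤ N * (1 - r) := by
    have : (N : ℝ) * r ≤ 1 := by linarith
    linarith
  calc ((N : ℝ) - 1) * (r * y + r * z) ≤ (N * (1 - r)) * (r * y + r * z) := by gcongr
    _ = (N * r) * ((1 - r) * (y + z)) := by ring
    _ ≤ (N * r) * 1 := by gcongr
    _ = δ := by rw [hNr, mul_one]

/-- The abstract concentration statement. -/
theorem conc_aux {α V : Type*} [Fintype V] (u : V) (w : α → ℝ) (X : V → α → ℝ) (μ : V → ℝ)
    (h0 : ∀ a, 0 ≤ w a) (hw : HasSum w 1)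
    (hX : ∀ v, v ≠ u → ∀ a, w a = 0 ∨ (0 ≤ X v a ∧ X v a ≤ 1))
    (hμ : ∀ v, v ≠ u → HasSum (fun a => w a * X v a) (μ v))
    (c : ℝ) (hc0 : 0 < c) (hμc : ∀ v, v ≠ u → μ v ≤ c)
    (ε δ : ℝ) (hε0 : 0 < ε) (hεc : ε ≤ c) (hδ0 : 0 < δ) (hδ1 : δ < 1)
    (n : ℕ) (hn : 3 * c / ε ^ 2 * Real.log ((Fintype.card V : ℝ) / δ) ≤ n) :
    1 - δ ≤ ∑' W : Fin n → α, (∏ k, w (W k)) *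
      (if ∀ v, v ≠ u → |(1 / (n : ℝ)) * (∑ k, X v (W k)) - μ v| ≤ ε then 1 else 0) := by
  have hcard : 0 < Fintype.card V := Fintype.card_pos_iff.2 ⟨u⟩
  have hcard' : (1 : ℝ) ≤ Fintype.card V := by exact_mod_cast hcard
  have hL : 0 < Real.log ((Fintype.card V : ℝ) / δ) := by
    apply Real.log_pos
    rw [lt_div_iff₀ hδ0]; linarith
  set L := Real.log ((Fintype.card V : ℝ) / δ) with hLdef
  have hn0 : (0 : ℝ) < n := lt_of_lt_of_le (by positivity) hn
  set x := ε / c with hx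
  have hx0 : 0 < x := by positivity
  have hx1 : x ≤ 1 := by rw [hx, div_le_one hc0]; exact hεc
  have hεx : ε = c * x := by rw [hx]; field_simp
  have hnx : 3 * L ≤ n * c * x ^ 2 := by
    have := mul_le_mul_of_nonneg_right hn (by positivity : 0 ≤ c * x ^ 2)
    have e : 3 * c / ε ^ 2 * L * (c * x ^ 2) = 3 * L := by rw [hεx]; field_simp
    rw [e] at this; linarith
  have hexp : ∀ l, 0 ≤ Real.exp l - 1 - l := fun l => by linarith [Real.add_one_le_exp l]
  have up : ∀ v, v ≠ u → ∃ m, HasSum (fun W : Fin n → α => (∏ k, w (W k)) *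
      Real.exp ((7 / 10 * x) * (∑ k, X v (W k)) + -(7 / 10 * x) * (n * (μ v + ε)))) m ∧
      m ≤ Real.exp (-(8 / 7) * L) := by
    intro v hv
    obtain ⟨m, hm, hm1⟩ := tail_aux w (X v) (μ v) (7 / 10 * x) (-(7 / 10 * x) * (n * (μ v + ε))) n
      h0 hw (hX v hv) (hμ v hv)
    refine ⟨m, hm, hm1.trans (Real.exp_le_exp.2 ?_)⟩
    have h1 := upper_exp (7 / 10 * x) (by positivity) (by linarith)
    have h2 := mul_le_mul_of_nonneg_right (hμc v hv) (hexp (7 / 10 * x))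
    have h3 := mul_le_mul_of_nonneg_left h1 hc0.le
    have h4 : μ v * (Real.exp (7 / 10 * x) - 1 - 7 / 10 * x) - (7 / 10 * x) * ε
        ≤ -(8 / 21) * (c * x ^ 2) := by
      rw [hεx]
      nlinarith [mul_pos hc0 (pow_pos hx0 2)]
    have h5 := mul_le_mul_of_nonneg_left h4 hn0.le
    nlinarith
  have lo : ∀ v, v ≠ u → ∃ m, HasSum (fun W : Fin n → α => (∏ k, w (W k)) *
      Real.exp ((-x) * (∑ k, X v (W k)) + x * (n * (μ v - ε)))) m ∧
      m ≤ Real.exp (-(3 / 2) * L) := by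
    intro v hv
    obtain ⟨m, hm, hm1⟩ := tail_aux w (X v) (μ v) (-x) (x * (n * (μ v - ε))) n
      h0 hw (hX v hv) (hμ v hv)
    refine ⟨m, hm, hm1.trans (Real.exp_le_exp.2 ?_)⟩
    have h1 := lower_exp x hx0.le
    have h2 := mul_le_mul_of_nonneg_right (hμc v hv) (hexp (-x))
    have h3 := mul_le_mul_of_nonneg_left h1 hc0.le
    have h4 : μ v * (Real.exp (-x) - 1 + x) - x * ε ≤ -(1 / 2) * (c * x ^ 2) := by
      rw [hεx]
      nlinarith
    have h5 := mul_le_mul_of_nonneg_left h4 hn0.le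
    nlinarith
  choose! mu hmu hmu1 using up
  choose! ml hml hml1 using lo
  have hW := hasSum_pi_aux w 1 hw h0 n
  rw [one_pow] at hW
  have hW0 : ∀ W : Fin n → α, 0 ≤ ∏ k, w (W k) := fun W => Finset.prod_nonneg (fun k _ => h0 _)
  have hS := hasSum_sum (s := Finset.univ.erase u)
    (fun v hv => (hmu v (Finset.ne_of_mem_erase hv)).add (hml v (Finset.ne_of_mem_erase hv)))
  have hD := hW.sub hS
  have hsumm : Summable (fun W : Fin n → α => (∏ k, w (W k)) *
      (if ∀ v, v ≠ u → |(1 / (n : ℝ)) * (∑ k, X v (W k)) - μ v| ≤ ε then (1 : ℝ) else 0)) := by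
    refine Summable.of_nonneg_of_le (fun W => ?_) (fun W => ?_) hW.summable
    · have := hW0 W
      split_ifs <;> simp [this]
    · have := hW0 W
      split_ifs <;> simp [this]
  refine le_trans ?_ (hasSum_le (fun W => ?_) hD hsumm.hasSum)
  · have : ∑ v ∈ Finset.univ.erase u, (mu v + ml v) ≤
        ∑ v ∈ Finset.univ.erase u, (Real.exp (-(8 / 7) * L) + Real.exp (-(3 / 2) * L)) :=
      Finset.sum_le_sum (fun v hv => add_le_add (hmu1 v (Finset.ne_of_mem_erase hv))
        (hml1 v (Finset.ne_of_mem_erase hv)))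
    rw [Finset.sum_const, Finset.card_erase_of_mem (Finset.mem_univ u), Finset.card_univ,
      nsmul_eq_mul, Nat.cast_sub hcard, Nat.cast_one] at this
    have h2 := final_num (Fintype.card V) hcard δ hδ0 hδ1
    linarith
  · have hnn : ∀ v ∈ Finset.univ.erase u, 0 ≤ (∏ k, w (W k)) *
        Real.exp ((7 / 10 * x) * (∑ k, X v (W k)) + -(7 / 10 * x) * (n * (μ v + ε))) +
        (∏ k, w (W k)) * Real.exp ((-x) * (∑ k, X v (W k)) + x * (n * (μ v - ε))) :=
      fun v _ => add_nonneg (mul_nonneg (hW0 W) (Real.exp_pos _).le)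
        (mul_nonneg (hW0 W) (Real.exp_pos _).le)
    by_cases hg : ∀ v, v ≠ u → |(1 / (n : ℝ)) * (∑ k, X v (W k)) - μ v| ≤ ε
    · rw [if_pos hg]
      have := Finset.sum_nonneg hnn
      linarith
    · rw [if_neg hg]
      push Not at hg
      obtain ⟨v, hv, hbad⟩ := hg
      have hle := Finset.single_le_sum hnn (Finset.mem_erase.2 ⟨hv, Finset.mem_univ v⟩)
      refine le_trans (sub_le_sub_left hle _) ?_
      rw [mul_zero]
      set S := ∑ k, X v (W k)
      have p1 := mul_nonneg (hW0 W)
        (Real.exp_pos ((7 / 10 * x) * S + -(7 / 10 * x) * (n * (μ v + ε)))).le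
      have p2 := mul_nonneg (hW0 W) (Real.exp_pos ((-x) * S + x * (n * (μ v - ε)))).le
      have hSn : 1 / (n : ℝ) * S * n = S := by field_simp
      rcases lt_abs.1 hbad with hb | hb
      · have h1 : n * (μ v + ε) ≤ S := by nlinarith
        have h2 : 1 ≤ Real.exp ((7 / 10 * x) * S + -(7 / 10 * x) * (n * (μ v + ε))) := by
          apply Real.one_le_exp
          have := mul_le_mul_of_nonneg_left h1 (by positivity : 0 ≤ 7 / 10 * x)
          linarith
        have := mul_le_mul_of_nonneg_left h2 (hW0 W)
        linarith
      · have h1 : S ≤ n * (μ v - ε) := by nlinarith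
        have h2 : 1 ≤ Real.exp ((-x) * S + x * (n * (μ v - ε))) := by
          apply Real.one_le_exp
          have := mul_le_mul_of_nonneg_left h1 hx0.le
          linarith
        have := mul_le_mul_of_nonneg_left h2 (hW0 W)
        linarith

end generic

section walks

theorem walkWeight_nil (I : V → Finset V) (c : ℝ) (v : V) : walkWeight I c v [] = 0 := by
  simp [walkWeight, IsWalkFrom]

theorem walkWeight_cons_ne (I : V → Finset V) (c : ℝ) (v a : V) (q : List V) (h : a ≠ v) :
    walkWeight I c v (a :: q) = 0 := by
  simp [walkWeight, IsWalkFrom, h]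

theorem walkWeight_cons (I : V → Finset V) (c : ℝ) (v : V) (q : List V) :
    walkWeight I c v (v :: q) = (if q = [] then 1 - Real.sqrt c else 0) +
      ∑ x ∈ I v, Real.sqrt c / ((I v).card : ℝ) * walkWeight I c x q := by
  cases q with
  | nil =>
    simp only [walkWeight_nil, mul_zero, Finset.sum_const_zero, add_zero, if_true]
    have : IsWalkFrom I v [v] := ⟨rfl, List.isChain_singleton _⟩
    simp [walkWeight, this]
  | cons b t =>
    have hs : ∑ x ∈ I v, Real.sqrt c / ((I v).card : ℝ) * walkWeight I c x (b :: t) =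
        if b ∈ I v then Real.sqrt c / ((I v).card : ℝ) * walkWeight I c b (b :: t) else 0 := by
      rw [← Finset.sum_ite_eq (I v) b
        (fun x => Real.sqrt c / ((I v).card : ℝ) * walkWeight I c x (b :: t))]
      refine Finset.sum_congr rfl (fun x _ => ?_)
      split_ifs with h
      · rfl
      · rw [walkWeight_cons_ne I c x b t h, mul_zero]
    rw [hs]
    simp only [reduceCtorEq, if_false, zero_add]
    have hiff : IsWalkFrom I v (v :: b :: t) ↔ b ∈ I v ∧ IsWalkFrom I b (b :: t) := by
      unfold IsWalkFrom
      constructor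
      · rintro ⟨_, h⟩
        have h' := List.isChain_cons.1 h
        exact ⟨h'.1 b rfl, rfl, h'.2⟩
      · rintro ⟨hb, _, h⟩
        refine ⟨rfl, List.isChain_cons.2 ⟨?_, h⟩⟩
        intro y hy
        simp at hy
        exact hy ▸ hb
    by_cases hb : b ∈ I v
    · rw [if_pos hb]
      unfold walkWeight
      by_cases hw : IsWalkFrom I b (b :: t)
      · rw [if_pos (hiff.2 ⟨hb, hw⟩), if_pos hw]
        have e : (v :: b :: t).length - 1 = t.length + 1 := by simp
        have e2 : (b :: t).length - 1 = t.length := by simp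
        rw [e, e2, Finset.prod_range_succ']
        have : ∀ k ∈ Finset.range t.length,
            Real.sqrt c / ((I ((v :: b :: t).getD (k + 1) v)).card : ℝ) =
            Real.sqrt c / ((I ((b :: t).getD k b)).card : ℝ) := by
          intro k hk
          have hk' : k < (b :: t).length := by
            have := Finset.mem_range.1 hk
            simp; omega
          rw [List.getD_cons_succ, List.getD_eq_getElem _ _ hk', List.getD_eq_getElem _ _ hk']
        rw [Finset.prod_congr rfl this]
        simp only [List.getD_cons_zero]
        ring
      · rw [if_neg (fun h => hw (hiff.1 h).2), if_neg hw, mul_zero]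
    · rw [if_neg hb]
      unfold walkWeight
      rw [if_neg (fun h => hb (hiff.1 h).1)]

theorem walkWeight_nonneg (I : V → Finset V) (c : ℝ) (hc1 : c < 1) (v : V)
    (p : List V) : 0 ≤ walkWeight I c v p := by
  unfold walkWeight
  have : 0 ≤ 1 - Real.sqrt c := by
    rw [sub_nonneg]; exact Real.sqrt_le_one.2 hc1.le
  split_ifs
  · exact mul_nonneg this (Finset.prod_nonneg (fun _ _ => by positivity))
  · exact le_rfl

theorem kappa_nonneg (I : V → Finset V) (c : ℝ) (v : V) :
    0 ≤ Real.sqrt c / ((I v).card : ℝ) :=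
  div_nonneg (Real.sqrt_nonneg c) (Nat.cast_nonneg _)

theorem sum_kappa (I : V → Finset V) (hI : ∀ v, (I v).Nonempty) (c : ℝ) (v : V) :
    ∑ _x ∈ I v, Real.sqrt c / ((I v).card : ℝ) = Real.sqrt c := by
  have : (0 : ℝ) < (I v).card := by exact_mod_cast (hI v).card_pos
  rw [Finset.sum_const, nsmul_eq_mul]
  field_simp

theorem walk_sum_le (I : V → Finset V) (hI : ∀ v, (I v).Nonempty) (c : ℝ)
    (hc1 : c < 1) (N : ℕ) : ∀ (v : V) (S : Finset (List V)), (∀ p ∈ S, p.length ≤ N) →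
      ∑ p ∈ S, walkWeight I c v p ≤ 1 := by
  have h1 : 0 ≤ 1 - Real.sqrt c := by
    rw [sub_nonneg]; exact Real.sqrt_le_one.2 hc1.le
  induction N with
  | zero =>
    intro v S hS
    rw [Finset.sum_eq_zero]
    · norm_num
    · intro p hp
      have := List.length_eq_zero_iff.1 (Nat.le_zero.1 (hS p hp))
      rw [this, walkWeight_nil]
  | succ N ih =>
    intro v S hS
    have hinj : Set.InjOn (List.cons v) (List.cons v ⁻¹' (S : Set (List V))) :=
      List.cons_injective.injOn
    rw [← Finset.sum_preimage (List.cons v) S hinj]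
    · simp only [walkWeight_cons]
      rw [Finset.sum_add_distrib, Finset.sum_comm]
      have b1 : ∑ q ∈ S.preimage (List.cons v) hinj, (if q = [] then 1 - Real.sqrt c else 0)
          ≤ 1 - Real.sqrt c := by
        rw [Finset.sum_ite_eq']
        split_ifs <;> linarith
      have b2 : ∑ x ∈ I v, ∑ q ∈ S.preimage (List.cons v) hinj,
          Real.sqrt c / ((I v).card : ℝ) * walkWeight I c x q ≤ Real.sqrt c := by
        refine le_trans ?_ (sum_kappa I hI c v).le
        refine Finset.sum_le_sum (fun x _ => ?_)
        rw [← Finset.mul_sum]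
        refine mul_le_of_le_one_right (kappa_nonneg I c v) (ih x _ ?_)
        intro q hq
        have := hS _ (Finset.mem_preimage.1 hq)
        simpa using this
      linarith
    · intro p _ hp
      cases p with
      | nil => exact walkWeight_nil I c v
      | cons a q =>
        apply walkWeight_cons_ne
        rintro rfl
        exact hp ⟨q, rfl⟩

theorem walk_summable (I : V → Finset V) (hI : ∀ v, (I v).Nonempty) (c : ℝ)
    (hc1 : c < 1) (v : V) : Summable (walkWeight I c v) := by
  refine summable_of_sum_le (c := 1) (fun p => walkWeight_nonneg I c hc1 v p) (fun S => ?_)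
  exact walk_sum_le I hI c hc1 (S.sup List.length) v S
    (fun p hp => Finset.le_sup (f := List.length) hp)

theorem walk_rec (I : V → Finset V) (c : ℝ) (v : V) (F : List V → ℝ) (e : V → ℝ)
    (h : ∀ x ∈ I v, HasSum (fun q => walkWeight I c x q * F (v :: q)) (e x)) :
    HasSum (fun p => walkWeight I c v p * F p)
      ((1 - Real.sqrt c) * F [v] + ∑ x ∈ I v, Real.sqrt c / ((I v).card : ℝ) * e x) := by
  have hinj : Function.Injective (List.cons v) := List.cons_injective
  rw [← hinj.hasSum_iff]
  · have h1 : HasSum (fun q : List V => (if q = [] then (1 - Real.sqrt c) * F [v] else 0))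
        ((1 - Real.sqrt c) * F [v]) := hasSum_ite_eq [] _
    have h2 := hasSum_sum (s := I v)
      (fun x hx => (h x hx).mul_left (Real.sqrt c / ((I v).card : ℝ)))
    have h3 := h1.add h2
    have h4 : (fun p => walkWeight I c v p * F p) ∘ List.cons v =
        fun q : List V => (if q = [] then (1 - Real.sqrt c) * F [v] else 0) +
          ∑ x ∈ I v, Real.sqrt c / ((I v).card : ℝ) * (walkWeight I c x q * F (v :: q)) := by
      funext q
      simp only [Function.comp, walkWeight_cons, add_mul, Finset.sum_mul, mul_assoc]
      congr 1
      by_cases hq : q = [] <;> simp [hq]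
    rw [h4]
    exact h3
  · intro p hp
    cases p with
    | nil => rw [walkWeight_nil, zero_mul]
    | cons a q =>
      rw [walkWeight_cons_ne, zero_mul]
      rintro rfl
      exact hp ⟨q, rfl⟩

theorem walk_hasSum [Fintype V] (I : V → Finset V) (hI : ∀ v, (I v).Nonempty) (c : ℝ)
    (hc1 : c < 1) (v : V) : HasSum (walkWeight I c v) 1 := by
  have hs := walk_summable I hI c hc1
  have hlt : Real.sqrt c < 1 := by
    rw [Real.sqrt_lt' one_pos]; simpa using hc1
  set t : V → ℝ := fun x => ∑' p, walkWeight I c x p with ht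
  have hrec : ∀ x, t x = (1 - Real.sqrt c) + ∑ y ∈ I x, Real.sqrt c / ((I x).card : ℝ) * t y := by
    intro x
    have h := walk_rec I c x (fun _ => 1) t (fun y _ => by simpa using (hs y).hasSum)
    simp only [mul_one] at h
    exact h.tsum_eq
  have hdiff : ∀ x, t x - 1 = ∑ y ∈ I x, Real.sqrt c / ((I x).card : ℝ) * (t y - 1) := by
    intro x
    simp only [mul_sub, mul_one, Finset.sum_sub_distrib, sum_kappa I hI c x]
    rw [hrec x]; ring
  obtain ⟨m, -, hm⟩ := Finset.exists_max_image Finset.univ (fun x => |t x - 1|)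
    ⟨v, Finset.mem_univ v⟩
  have hb : |t m - 1| ≤ Real.sqrt c * |t m - 1| := by
    calc |t m - 1| = |∑ y ∈ I m, Real.sqrt c / ((I m).card : ℝ) * (t y - 1)| := by rw [← hdiff]
      _ ≤ ∑ y ∈ I m, |Real.sqrt c / ((I m).card : ℝ) * (t y - 1)| :=
        Finset.abs_sum_le_sum_abs _ _
      _ ≤ ∑ y ∈ I m, Real.sqrt c / ((I m).card : ℝ) * |t m - 1| := by
        refine Finset.sum_le_sum (fun y _ => ?_)
        rw [abs_mul, abs_of_nonneg (kappa_nonneg I c m)]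
        exact mul_le_mul_of_nonneg_left (hm y (Finset.mem_univ y)) (kappa_nonneg I c m)
      _ = Real.sqrt c * |t m - 1| := by rw [← Finset.sum_mul, sum_kappa I hI c m]
  have h0 : |t m - 1| ≤ 0 := by nlinarith [abs_nonneg (t m - 1)]
  have hv : |t v - 1| ≤ 0 := (hm v (Finset.mem_univ v)).trans h0
  have : t v = 1 := by
    have := abs_nonpos_iff.1 hv
    linarith
  rw [← this]
  exact (hs v).hasSum

/-- Estimator that also counts the first position. -/
noncomputable def estOne (I : V → Finset V) (c : ℝ) (p : List V) (v : V) : ℝ :=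
  ∑ i ∈ Finset.range p.length, Score I c ((p.take (i + 1)).reverse) i v

theorem score_append (I : V → Finset V) (c : ℝ) (q : List V) (a : V) (j : ℕ) (hj : j < q.length) :
    ∀ v, Score I c (q ++ [a]) j v = Score I c q j v := by
  induction j with
  | zero =>
    intro v
    cases q with
    | nil => simp at hj
    | cons b t => simp [Score]
  | succ j ih =>
    intro v
    simp only [Score, List.getElem?_append_left hj, ih (by omega)]

theorem score_step (I : V → Finset V) (c : ℝ) (p : List V) (a v : V) (i : ℕ) (hi : i < p.length) :
    Score I c (((a :: p).take (i + 2)).reverse) (i + 1) v =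
      if a = v then 0 else
        ∑ x ∈ I v, Real.sqrt c / ((I v).card : ℝ) * Score I c ((p.take (i + 1)).reverse) i x := by
  have e : ((a :: p).take (i + 2)).reverse = (p.take (i + 1)).reverse ++ [a] := by
    simp
  have hl : (p.take (i + 1)).reverse.length = i + 1 := by
    simp; omega
  rw [e]
  simp only [Score]
  have e2 : ((p.take (i + 1)).reverse ++ [a])[i + 1]? = some a := by
    rw [List.getElem?_append_right (by omega), hl]; simp
  rw [e2]
  simp only [Option.some.injEq]
  split_ifs
  · rfl
  · refine Finset.sum_congr rfl (fun x _ => ?_)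
    rw [score_append I c _ a i (by omega)]

theorem estOne_cons (I : V → Finset V) (c : ℝ) (p : List V) (a v : V) :
    estOne I c (a :: p) v = if a = v then 1 else
        ∑ x ∈ I v, Real.sqrt c / ((I v).card : ℝ) * estOne I c p x := by
  unfold estOne
  rw [List.length_cons, Finset.sum_range_succ']
  rw [Finset.sum_congr rfl (fun i hi => score_step I c p a v i (Finset.mem_range.1 hi))]
  by_cases h : a = v
  · simp [h, Score]
  · simp only [h, if_false, Finset.mul_sum]
    rw [Finset.sum_comm]
    simp [Score, h]

theorem estimator_eq (I : V → Finset V) (c : ℝ) (p : List V) (a v : V) (h : a ≠ v) :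
    estimator I c (a :: p) v = estOne I c (a :: p) v := by
  unfold estimator estOne
  rw [List.length_cons, Finset.sum_range_succ', ← Finset.Ico_succ_right_eq_Icc,
    Finset.sum_Ico_eq_sum_range]
  have : (if ((a :: p).take 1).reverse.head? = some v then (1 : ℝ) else 0) = 0 := by simp [h]
  simp only [Score, this, zero_add, add_zero]
  refine Finset.sum_congr (by simp) (fun i _ => ?_)
  have e1 : 2 + i = i + 1 + 1 := by omega
  rw [e1]
  rfl

theorem meets_cons (a v : V) (p q : List V) (h : a ≠ v) :
    Meets (a :: p) (v :: q) ↔ Meets p q := by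
  constructor
  · rintro ⟨k, h1, h2, h3⟩
    cases k with
    | zero => simp at h3; exact absurd h3 h
    | succ k =>
      exact ⟨k, by simpa using h1, by simpa using h2, by simpa using h3⟩
  · rintro ⟨k, h1, h2, h3⟩
    exact ⟨k + 1, by simpa using h1, by simpa using h2, by simpa using h3⟩

theorem estOne_hasSum [Fintype V] (I : V → Finset V) (hI : ∀ v, (I v).Nonempty) (c : ℝ)
    (hc1 : c < 1) (p : List V) : ∀ v, HasSum
      (fun q => walkWeight I c v q * (if Meets p q then 1 else 0)) (estOne I c p v) := by
  induction p with
  | nil =>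
    intro v
    have : ∀ q : List V, ¬ Meets [] q := by
      rintro q ⟨k, h, _⟩
      simp at h
    simp [this, estOne, hasSum_zero]
  | cons a p ih =>
    intro v
    rw [estOne_cons]
    split_ifs with h
    · subst h
      convert walk_hasSum I hI c hc1 a using 2 with q
      cases q with
      | nil => simp [walkWeight_nil]
      | cons b q =>
        by_cases hb : b = a
        · subst hb
          rw [if_pos ⟨0, by simp, by simp, by simp⟩, mul_one]
        · rw [walkWeight_cons_ne I c a b q hb, zero_mul]
    · have hr := walk_rec I c v (fun q => if Meets (a :: p) q then 1 else 0) (estOne I c p)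
        (fun x _ => by simpa only [meets_cons a v p _ h] using ih x)
      have hn : ¬ Meets (a :: p) [v] := by
        rw [meets_cons a v p [] h]
        rintro ⟨k, _, hk, _⟩
        simp at hk
      simpa only [if_neg hn, mul_zero, zero_add] using hr

theorem est_bounds [Fintype V] (I : V → Finset V) (hI : ∀ v, (I v).Nonempty) (c : ℝ)
    (hc1 : c < 1) (p : List V) (v : V) : 0 ≤ estOne I c p v ∧ estOne I c p v ≤ 1 := by
  have h := estOne_hasSum I hI c hc1 p v
  have h0 := walkWeight_nonneg I c hc1 v
  constructor
  · refine h.nonneg (fun q => ?_)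
    have := h0 q
    split_ifs <;> simp [this]
  · refine hasSum_le (fun q => ?_) h (walk_hasSum I hI c hc1 v)
    have := h0 q
    split_ifs <;> simp [this]

theorem pair_hasSum [Fintype V] (I : V → Finset V) (hI : ∀ v, (I v).Nonempty) (c : ℝ)
    (hc1 : c < 1) (u v : V) : HasSum (fun w : List V × List V =>
      walkWeight I c u w.1 * walkWeight I c v w.2 * (if Meets w.1 w.2 then 1 else 0))
      (simRank I c u v) := by
  have hu := walk_hasSum I hI c hc1 u
  have hv := walk_hasSum I hI c hc1 v
  have h0 := walkWeight_nonneg I c hc1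
  have hs : Summable (fun w : List V × List V => walkWeight I c u w.1 * walkWeight I c v w.2) :=
    hu.summable.mul_of_nonneg hv.summable (h0 u) (h0 v)
  refine (Summable.of_nonneg_of_le (fun w => ?_) (fun w => ?_) hs).hasSum
  · have := mul_nonneg (h0 u w.1) (h0 v w.2)
    split_ifs <;> simp [this]
  · have := mul_nonneg (h0 u w.1) (h0 v w.2)
    split_ifs <;> simp [this]

theorem est_mean [Fintype V] (I : V → Finset V) (hI : ∀ v, (I v).Nonempty) (c : ℝ)
    (hc1 : c < 1) (u v : V) :
    HasSum (fun p => walkWeight I c u p * estOne I c p v) (simRank I c u v) := by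
  refine (pair_hasSum I hI c hc1 u v).prod_fiberwise (fun p => ?_)
  have := (estOne_hasSum I hI c hc1 p v).mul_left (walkWeight I c u p)
  simpa only [mul_assoc] using this

theorem long_hasSum [Fintype V] (I : V → Finset V) (hI : ∀ v, (I v).Nonempty) (c : ℝ)
    (hc1 : c < 1) (v : V) :
    HasSum (fun p => walkWeight I c v p * (if p = [v] then 0 else 1)) (Real.sqrt c) := by
  have h1 := walk_hasSum I hI c hc1 v
  have hw : walkWeight I c v [v] = 1 - Real.sqrt c := by
    rw [walkWeight_cons]; simp [walkWeight_nil]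
  have h2 : HasSum (fun p : List V => if p = [v] then 1 - Real.sqrt c else 0) (1 - Real.sqrt c) :=
    hasSum_ite_eq [v] _
  have h3 := h1.sub h2
  have e : (1 : ℝ) - (1 - Real.sqrt c) = Real.sqrt c := by ring
  rw [e] at h3
  have h4 : (fun p => walkWeight I c v p * (if p = [v] then (0 : ℝ) else 1)) =
      fun p => walkWeight I c v p - (if p = [v] then 1 - Real.sqrt c else 0) := by
    funext p
    by_cases hp : p = [v]
    · simp [hp, hw]
    · simp [hp]
  rw [h4]
  exact h3

theorem simRank_le [Fintype V] (I : V → Finset V) (hI : ∀ v, (I v).Nonempty) (c : ℝ)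
    (hc0 : 0 < c) (hc1 : c < 1) (u v : V) (huv : v ≠ u) : simRank I c u v ≤ c := by
  have hu := long_hasSum I hI c hc1 u
  have hv := long_hasSum I hI c hc1 v
  have h0 := walkWeight_nonneg I c hc1
  have g0 : ∀ v : V, ∀ p : List V, 0 ≤ walkWeight I c v p * (if p = [v] then 0 else 1) := by
    intro v p
    have := h0 v p
    split_ifs <;> simp [this]
  have hp := hu.mul hv (hu.summable.mul_of_nonneg hv.summable (g0 u) (g0 v))
  rw [Real.mul_self_sqrt hc0.le] at hp
  refine hasSum_le (fun w => ?_) (pair_hasSum I hI c hc1 u v) hp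
  obtain ⟨p, q⟩ := w
  dsimp only
  have hnn := mul_nonneg (g0 u p) (g0 v q)
  by_cases hm : Meets p q
  · cases p with
    | nil => simp [walkWeight_nil]
    | cons a p =>
    cases q with
    | nil => simp [walkWeight_nil]
    | cons b q =>
    by_cases ha : a = u
    swap
    · simp [walkWeight_cons_ne I c u a p ha]
    by_cases hb : b = v
    swap
    · simp [walkWeight_cons_ne I c v b q hb]
    subst ha hb
    have hm' := (meets_cons a b p q huv.symm).1 hm
    obtain ⟨k, h1, h2, _⟩ := hm'
    have n1 : p ≠ [] := by rintro rfl; simp at h1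
    have n2 : q ≠ [] := by rintro rfl; simp at h2
    simp [n1, n2, hm]
  · rw [if_neg hm, mul_zero]
    exact hnn

end walks

/-- Theorem 3.1: with `n_r = ⌈(3c/ε²)·log(n/δ)⌉` i.i.d. `√c`-walks from `u`,
with probability at least `1−δ` (over the joint choice of the walks),
simultaneously for all `v ≠ u` the averaged estimator `s̃(u,v)` satisfies
`|s̃(u,v) − s(u,v)| ≤ ε`. -/
theorem probeSim_single_source [Fintype V]
    (I : V → Finset V) (hI : ∀ v, (I v).Nonempty)
    (c : ℝ) (hc0 : 0 < c) (hc1 : c < 1)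
    (u : V) (ε δ : ℝ) (hε0 : 0 < ε) (hεc : ε ≤ c) (hδ0 : 0 < δ) (hδ1 : δ < 1) :
    1 - δ ≤
      ∑' W : Fin ⌈3 * c / ε ^ 2 * Real.log ((Fintype.card V : ℝ) / δ)⌉₊ → List V,
        (∏ k, walkWeight I c u (W k)) *
          (if ∀ v, v ≠ u →
              |(1 / (⌈3 * c / ε ^ 2 * Real.log ((Fintype.card V : ℝ) / δ)⌉₊ : ℝ)) *
                  (∑ k, estimator I c (W k) v) - simRank I c u v| ≤ ε
           then 1 else 0) := by
  have key := conc_aux u (walkWeight I c u) (fun v p => estimator I c p v)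
    (fun v => simRank I c u v) (walkWeight_nonneg I c hc1 u) (walk_hasSum I hI c hc1 u)
    (fun v hv p => by
      cases p with
      | nil => exact Or.inl (walkWeight_nil I c u)
      | cons a p =>
        by_cases ha : a = u
        · right
          rw [ha, estimator_eq I c p u v hv.symm]
          exact est_bounds I hI c hc1 _ v
        · exact Or.inl (walkWeight_cons_ne I c u a p ha))
    (fun v hv => by
      have h := est_mean I hI c hc1 u v
      have e : (fun p => walkWeight I c u p * estimator I c p v) =
          fun p => walkWeight I c u p * estOne I c p v := by
        funext p
        cases p with
        | nil => simp [walkWeight_nil]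
        | cons a p =>
          by_cases ha : a = u
          · rw [ha, estimator_eq I c p u v hv.symm]
          · simp [walkWeight_cons_ne I c u a p ha]
      rw [e]
      exact h)
    c hc0 (fun v hv => simRank_le I hI c hc0 hc1 u v hv) ε δ hε0 hεc hδ0 hδ1 _ (Nat.le_ceil _)
  exact key
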